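/- arXiv:2402.04461 — 3 statements merged into one kernel-verified Lean document; each statement's English description precedes it below -/
import Mathlib

section
/- Let Ω₁ and Ω₂ be standard Borel measurable spaces, let p_f be a probability measure on Ω₁ × Ω₂ (the full posterior), and let p̄ be any probability measure on Ω₁ (the working first-level posterior). Define the cut posterior p_c as the composition p_c = p̄ ⊗ₘ κ, where κ is a regular conditional distribution (disintegration kernel) of p_f given the first coordinate. Then for every probability measure q on Ω₁ × Ω₂ whose first-coordinate marginal equals p̄, one has KL(p_c ‖ p_f) ≤ KL(q ‖ p_f); i.e., p_c minimizes the Kullback–Leibler divergence to p_f over the class F = {q : q.map(fst) = p̄}. -/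
open MeasureTheory ProbabilityTheory ENNReal

open Classical in
/-- Kullback–Leibler divergence between two measures, with value `⊤` when `q` is not
absolutely continuous with respect to `p` (or the log-likelihood ratio is not integrable). -/
noncomputable def KL {Ω : Type*} [MeasurableSpace Ω] (q p : Measure Ω) : ℝ≥0∞ :=
  if q ≪ p ∧ Integrable (llr q p) q then ENNReal.ofReal (∫ x, llr q p x ∂q) else ⊤

/-- Between probability measures, `KL` agrees with Mathlib's Kullback–Leibler divergence. -/
theorem KL_eq_klDiv {Ω : Type*} [MeasurableSpace Ω] (q p : Measure Ω)
    [IsProbabilityMeasure q] [IsProbabilityMeasure p] :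
    KL q p = InformationTheory.klDiv q p := by
  simp [KL, InformationTheory.klDiv]

/-- The cut posterior `pbar ⊗ₘ κ` minimizes the KL divergence to the full posterior `p_f`
over the class of joint distributions whose first marginal is `pbar`. -/
theorem cut_posterior_KL_minimizer
    {Ω₁ Ω₂ : Type*} [MeasurableSpace Ω₁] [MeasurableSpace Ω₂]
    [StandardBorelSpace Ω₁] [StandardBorelSpace Ω₂]
    (p_f : Measure (Ω₁ × Ω₂)) [IsProbabilityMeasure p_f]
    (pbar : Measure Ω₁) [IsProbabilityMeasure pbar]
    (κ : Kernel Ω₁ Ω₂) [IsMarkovKernel κ]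
    (hκ : p_f = (p_f.map Prod.fst) ⊗ₘ κ)
    (q : Measure (Ω₁ × Ω₂)) [IsProbabilityMeasure q]
    (hq : q.map Prod.fst = pbar) :
    KL (pbar ⊗ₘ κ) p_f ≤ KL q p_f := by
  have : IsProbabilityMeasure (p_f.map Prod.fst) :=
    Measure.isProbabilityMeasure_map measurable_fst.aemeasurable
  rw [KL_eq_klDiv, KL_eq_klDiv]
  calc InformationTheory.klDiv (pbar ⊗ₘ κ) p_f
      = InformationTheory.klDiv (pbar ⊗ₘ κ) (p_f.map Prod.fst ⊗ₘ κ) := by rw [← hκ]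
    _ = InformationTheory.klDiv pbar (p_f.map Prod.fst) :=
        InformationTheory.klDiv_compProd_left _ _ _
    _ = InformationTheory.klDiv (q.map Prod.fst) (p_f.map Prod.fst) := by rw [hq]
    _ ≤ InformationTheory.klDiv q p_f := InformationTheory.klDiv_map_le _ _ measurable_fst
end

section
/- Chain rule for Kullback–Leibler divergence on a product space: let Ω₁ and Ω₂ be standard Borel measurable spaces and let q and p be probability measures on Ω₁ × Ω₂, with disintegrations q = (q.map(fst)) ⊗ₘ κ_q and p = (p.map(fst)) ⊗ₘ κ_p. Then KL(q ‖ p) = KL(q.map(fst) ‖ p.map(fst)) + ∫ KL(κ_q(x) ‖ κ_p(x)) d(q.map(fst))(x), where the equality holds in the extended nonnegative reals. -/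
open MeasureTheory ProbabilityTheory ENNReal

theorem rnDeriv_compProd_right {α β : Type*} [MeasurableSpace α] [MeasurableSpace β]
    [MeasurableSpace.CountableOrCountablyGenerated α β]
    (μ : Measure α) [IsFiniteMeasure μ] (κ η : Kernel α β) [IsFiniteKernel κ] [IsFiniteKernel η]
    (h : ∀ᵐ a ∂μ, κ a ≪ η a) :
    (μ ⊗ₘ κ).rnDeriv (μ ⊗ₘ η) =ᵐ[μ ⊗ₘ η] fun x ↦ κ.rnDeriv η x.1 x.2 := by
  have hm : Measurable fun x : α × β ↦ κ.rnDeriv η x.1 x.2 := κ.measurable_rnDeriv η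
  have h_eq : μ ⊗ₘ κ = (μ ⊗ₘ η).withDensity fun x ↦ κ.rnDeriv η x.1 x.2 := by
    ext s hs
    rw [Measure.compProd_apply hs, withDensity_apply _ hs, ← lintegral_indicator hs,
      Measure.lintegral_compProd (hm.indicator hs)]
    refine lintegral_congr_ae ?_
    filter_upwards [h] with a ha
    have hs' : MeasurableSet (Prod.mk a ⁻¹' s) := measurable_prodMk_left hs
    rw [← Measure.setLIntegral_rnDeriv ha, ← lintegral_indicator hs']
    refine lintegral_congr_ae ?_
    filter_upwards [Kernel.rnDeriv_eq_rnDeriv_measure (κ := κ) (η := η) (a := a)] with b hb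
    simp only [Set.indicator, hb]
    rfl
  rw [h_eq]
  exact Measure.rnDeriv_withDensity _ hm

/-- The conditional Kullback–Leibler divergence, expressed with composition-products, is the
average of the divergences between the kernels. -/
theorem klDiv_compProd_right {α β : Type*} [MeasurableSpace α] [MeasurableSpace β]
    [MeasurableSpace.CountableOrCountablyGenerated α β]
    (μ : Measure α) [IsFiniteMeasure μ] (κ η : Kernel α β) [IsFiniteKernel κ] [IsFiniteKernel η] :
    InformationTheory.klDiv (μ ⊗ₘ κ) (μ ⊗ₘ η)
      = ∫⁻ a, InformationTheory.klDiv (κ a) (η a) ∂μ := by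
  by_cases h : ∀ᵐ a ∂μ, κ a ≪ η a
  · rw [InformationTheory.klDiv_eq_lintegral_klFun_of_ac
      (Measure.absolutelyContinuous_compProd_right_iff.mpr h)]
    have hm : Measurable fun x : α × β ↦
        ENNReal.ofReal (InformationTheory.klFun (κ.rnDeriv η x.1 x.2).toReal) :=
      (InformationTheory.measurable_klFun.comp
        (κ.measurable_rnDeriv η).ennreal_toReal).ennreal_ofReal
    calc _ = ∫⁻ x, ENNReal.ofReal (InformationTheory.klFun (κ.rnDeriv η x.1 x.2).toReal)
            ∂(μ ⊗ₘ η) := by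
          refine lintegral_congr_ae ?_
          filter_upwards [rnDeriv_compProd_right μ κ η h] with x hx
          rw [hx]
      _ = _ := by
          rw [Measure.lintegral_compProd hm]
          refine lintegral_congr_ae ?_
          filter_upwards [h] with a ha
          rw [InformationTheory.klDiv_eq_lintegral_klFun_of_ac ha]
          refine lintegral_congr_ae ?_
          filter_upwards [Kernel.rnDeriv_eq_rnDeriv_measure (κ := κ) (η := η) (a := a)] with b hb
          rw [hb]
  · rw [InformationTheory.klDiv_of_not_ac
      (mt Measure.absolutelyContinuous_compProd_right_iff.mp h), eq_comm, eq_top_iff]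
    have hs : MeasurableSet {a | κ a ≪ η a}ᶜ :=
      (Kernel.measurableSet_absolutelyContinuous κ η).compl
    calc (⊤ : ℝ≥0∞) = ∫⁻ _ in {a | κ a ≪ η a}ᶜ, ⊤ ∂μ := by
          rw [setLIntegral_const, ENNReal.top_mul]
          exact fun h0 ↦ h (ae_iff.mpr h0)
      _ = ∫⁻ a in {a | κ a ≪ η a}ᶜ, InformationTheory.klDiv (κ a) (η a) ∂μ :=
          setLIntegral_congr_fun hs fun a ha ↦ (InformationTheory.klDiv_of_not_ac ha).symm
      _ ≤ _ := setLIntegral_le_lintegral _ _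

/-- Chain rule for the Kullback–Leibler divergence on a product space: the KL divergence
between two joint distributions is the KL divergence between the first marginals plus the
average (over the first marginal of `q`) of the KL divergences between the conditional
distributions. -/
theorem KL_chain_rule
    {Ω₁ Ω₂ : Type*} [MeasurableSpace Ω₁] [MeasurableSpace Ω₂]
    [StandardBorelSpace Ω₁] [StandardBorelSpace Ω₂]
    (q p : Measure (Ω₁ × Ω₂)) [IsProbabilityMeasure q] [IsProbabilityMeasure p]
    (κq κp : Kernel Ω₁ Ω₂) [IsMarkovKernel κq] [IsMarkovKernel κp]
    (hq : q = (q.map Prod.fst) ⊗ₘ κq)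
    (hp : p = (p.map Prod.fst) ⊗ₘ κp) :
    KL q p = KL (q.map Prod.fst) (p.map Prod.fst)
      + ∫⁻ x, KL (κq x) (κp x) ∂(q.map Prod.fst) := by
  have : IsProbabilityMeasure (q.map Prod.fst) :=
    Measure.isProbabilityMeasure_map measurable_fst.aemeasurable
  have : IsProbabilityMeasure (p.map Prod.fst) :=
    Measure.isProbabilityMeasure_map measurable_fst.aemeasurable
  simp_rw [KL_eq_klDiv]
  rw [← klDiv_compProd_right, ← InformationTheory.klDiv_compProd_eq_add, ← hq, ← hp]
end

section
/- Full posterior in the matrix-variate linear model (flat prior): let X be a real N×K matrix with XᵀX invertible, W a real L×J matrix with WWᵀ invertible, σ², τ² > 0, Ω = σ²·I_J + τ²·WᵀW, and let Y be a fixed real N×J matrix. Then there exists a constant c > 0 such that for every real K×L matrix ξ, φ(vec(Y); vec(XξW), Ω ⊗ I_N) = c · φ(vec(ξ); vec(M_f), V_f ⊗ U_f), where M_f = (XᵀX)⁻¹ Xᵀ Y Ω⁻¹ Wᵀ (W Ω⁻¹ Wᵀ)⁻¹, U_f = (XᵀX)⁻¹, and V_f = σ²·(WWᵀ)⁻¹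 + τ²·I_L. -/
open MeasureTheory ProbabilityTheory Matrix ENNReal
open scoped Kronecker

instance matrixMeasurableSpace {m n : Type*} : MeasurableSpace (Matrix m n ℝ) :=
  (inferInstance : MeasurableSpace (m → n → ℝ))

/-- The Gaussian density `φ(z; m, Σ)` on `ι → ℝ` with mean `m` and covariance matrix `S`
(with respect to Lebesgue measure), under the convention that `S` is positive definite. -/
noncomputable def gaussDensity {ι : Type*} [Fintype ι] [DecidableEq ι]
    (m : ι → ℝ) (S : Matrix ι ι ℝ) (z : ι → ℝ) : ℝ :=
  (2 * Real.pi) ^ (-(Fintype.card ι : ℝ) / 2) * S.det ^ (-(1 : ℝ) / 2) *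
    Real.exp (-(1 / 2) * ((z - m) ⬝ᵥ (S⁻¹ *ᵥ (z - m))))

/-- The Gaussian measure on `ι → ℝ` with mean `m` and (positive definite) covariance `S`,
defined by its density with respect to Lebesgue measure. -/
noncomputable def gaussMeasure {ι : Type*} [Fintype ι] [DecidableEq ι]
    (m : ι → ℝ) (S : Matrix ι ι ℝ) : Measure (ι → ℝ) :=
  volume.withDensity fun z => ENNReal.ofReal (gaussDensity m S z)

/-- Column-stacking vectorization of an `N × J` matrix: `vecM A (j, i) = A i j`, so that
`vecM (A * B) = (Bᵀ ⊗ₖ 1) *ᵥ vecM A`. -/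
def vecM {N J : ℕ} (A : Matrix (Fin N) (Fin J) ℝ) : Fin J × Fin N → ℝ := fun p => A p.2 p.1

theorem gaussDensity_pos {ι : Type*} [Fintype ι] [DecidableEq ι] {S : Matrix ι ι ℝ}
    (hS : S.PosDef) (m z : ι → ℝ) : 0 < gaussDensity m S z := by
  have := hS.det_pos
  unfold gaussDensity
  positivity

/-- If the residual `y - D m` is `S⁻¹`-orthogonal to the range of `D`, the weighted sum of squares
splits off its value at `m`. -/
theorem dotProduct_mulVec_residual {ι κ : Type*} [Fintype ι] [Fintype κ]
    {P : Matrix ι ι ℝ} (hP : P.IsSymm) (D : Matrix ι κ ℝ) (y : ι → ℝ) (m : κ → ℝ)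
    (hm : (Dᵀ * P * D) *ᵥ m = (Dᵀ * P) *ᵥ y) (x : κ → ℝ) :
    (y - D *ᵥ x) ⬝ᵥ (P *ᵥ (y - D *ᵥ x)) =
      (y - D *ᵥ m) ⬝ᵥ (P *ᵥ (y - D *ᵥ m)) + (x - m) ⬝ᵥ ((Dᵀ * P * D) *ᵥ (x - m)) := by
  have hr : Dᵀ *ᵥ (P *ᵥ (y - D *ᵥ m)) = 0 := by
    rw [mulVec_sub, mulVec_sub, mulVec_mulVec, mulVec_mulVec, mulVec_mulVec, hm, sub_self]
  have hsplit : y - D *ᵥ x = (y - D *ᵥ m) - D *ᵥ (x - m) := by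
    rw [mulVec_sub]; abel
  have hadj (u : κ → ℝ) (v : ι → ℝ) : (D *ᵥ u) ⬝ᵥ v = u ⬝ᵥ (Dᵀ *ᵥ v) := by
    rw [dotProduct_mulVec, vecMul_transpose]
  have hsymm (u v : ι → ℝ) : u ⬝ᵥ (P *ᵥ v) = v ⬝ᵥ (P *ᵥ u) := by
    rw [dotProduct_mulVec, dotProduct_comm, ← mulVec_transpose, hP.eq]
  have hcross : (D *ᵥ (x - m)) ⬝ᵥ (P *ᵥ (y - D *ᵥ m)) = 0 := by
    rw [hadj, hr, dotProduct_zero]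
  have hquad : (D *ᵥ (x - m)) ⬝ᵥ (P *ᵥ (D *ᵥ (x - m))) =
      (x - m) ⬝ᵥ ((Dᵀ * P * D) *ᵥ (x - m)) := by
    rw [hadj, mulVec_mulVec, mulVec_mulVec]
  rw [hsplit, mulVec_sub P, dotProduct_sub, sub_dotProduct _ _ (P *ᵥ (y - D *ᵥ m)),
    sub_dotProduct _ _ (P *ᵥ (D *ᵥ (x - m))), hsymm (y - D *ᵥ m) (D *ᵥ (x - m)), hcross, hquad]
  ring

/-- Under a flat prior, a Gaussian likelihood with linear mean `D x` is proportional to a Gaussian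
density in `x` whose mean `m` solves the normal equations. -/
theorem gaussDensity_linear_eq {ι κ : Type*} [Fintype ι] [DecidableEq ι] [Fintype κ]
    [DecidableEq κ] {S : Matrix ι ι ℝ} (hS : S.PosDef) {T : Matrix κ κ ℝ} (hT : T.PosDef)
    (D : Matrix ι κ ℝ) (y : ι → ℝ) (m : κ → ℝ) (hTD : T⁻¹ = Dᵀ * S⁻¹ * D)
    (hm : T⁻¹ *ᵥ m = (Dᵀ * S⁻¹) *ᵥ y) (x : κ → ℝ) :
    gaussDensity (D *ᵥ x) S y =
      gaussDensity (D *ᵥ m) S y / gaussDensity m T m * gaussDensity m T x := by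
  have hP : (S⁻¹).IsSymm := by simpa using hS.inv.isHermitian
  rw [div_mul_eq_mul_div, eq_div_iff (gaussDensity_pos hT m m).ne']
  unfold gaussDensity
  rw [dotProduct_mulVec_residual hP D y m (hTD ▸ hm) x, ← hTD, mul_add, Real.exp_add, sub_self,
    zero_dotProduct, mul_zero, Real.exp_zero]
  ring

/-- The precision `W Ω⁻¹ Wᵀ` of the generalized least squares estimator, for
`Ω = a I + b Wᵀ W`. -/
theorem inv_smul_inv_add_smul_one {l j : Type*} [Fintype l] [DecidableEq l] [Fintype j]
    [DecidableEq j] (W : Matrix l j ℝ) (hW : IsUnit (W * Wᵀ).det) (a b : ℝ)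
    (hΩ : IsUnit (a • (1 : Matrix j j ℝ) + b • (Wᵀ * W)).det) :
    (a • (W * Wᵀ)⁻¹ + b • (1 : Matrix l l ℝ))⁻¹ =
      W * (a • (1 : Matrix j j ℝ) + b • (Wᵀ * W))⁻¹ * Wᵀ := by
  set Ω := a • (1 : Matrix j j ℝ) + b • (Wᵀ * W) with hΩdef
  set V := a • (W * Wᵀ)⁻¹ + b • (1 : Matrix l l ℝ) with hV
  have hVG : V * (W * Wᵀ) = a • (1 : Matrix l l ℝ) + b • (W * Wᵀ) := by
    rw [hV, Matrix.add_mul, Matrix.smul_mul, Matrix.smul_mul, nonsing_inv_mul _ hW, Matrix.one_mul]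
  have hcomm : Wᵀ * (V * (W * Wᵀ)) = Ω * Wᵀ := by
    rw [hVG, hΩdef]
    simp only [Matrix.mul_add, Matrix.add_mul, Matrix.smul_mul, Matrix.mul_smul, Matrix.one_mul,
      Matrix.mul_one, Matrix.mul_assoc]
  refine inv_eq_left_inv ?_
  have h : W * Ω⁻¹ * Wᵀ * V * (W * Wᵀ) = 1 * (W * Wᵀ) := by
    rw [Matrix.mul_assoc _ V, Matrix.mul_assoc _ Wᵀ, hcomm, Matrix.mul_assoc W,
      nonsing_inv_mul_cancel_left _ _ hΩ, Matrix.one_mul]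
  exact ((isUnit_iff_isUnit_det _).mpr hW).mul_right_cancel h

theorem posDef_mul_transpose_of_isUnit_det {m n : Type*} [Fintype m] [DecidableEq m] [Fintype n]
    (A : Matrix m n ℝ) (hA : IsUnit (A * Aᵀ).det) : (A * Aᵀ).PosDef := by
  have h : (A * Aᵀ).PosSemidef := by simpa using posSemidef_self_mul_conjTranspose A
  exact h.posDef_iff_isUnit.mpr ((isUnit_iff_isUnit_det _).mpr hA)

/-- Full posterior in the matrix-variate linear model under a flat prior on `ξ`:
the marginal likelihood density, as a function of `ξ`, is proportional to a
matrix-variate normal density `MN(M_f, U_f, V_f)` in `ξ`. -/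
theorem full_posterior_matrix_variate
    {N K L J : ℕ}
    (X : Matrix (Fin N) (Fin K) ℝ) (hX : IsUnit (Xᵀ * X).det)
    (W : Matrix (Fin L) (Fin J) ℝ) (hW : IsUnit (W * Wᵀ).det)
    (σ2 τ2 : ℝ) (hσ : 0 < σ2) (hτ : 0 < τ2)
    (Ωm : Matrix (Fin J) (Fin J) ℝ)
    (hΩ : Ωm = σ2 • (1 : Matrix (Fin J) (Fin J) ℝ) + τ2 • (Wᵀ * W))
    (Y : Matrix (Fin N) (Fin J) ℝ) :
    ∃ c : ℝ, 0 < c ∧ ∀ ξ : Matrix (Fin K) (Fin L) ℝ,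
      gaussDensity (vecM (X * ξ * W)) (Ωm ⊗ₖ (1 : Matrix (Fin N) (Fin N) ℝ)) (vecM Y)
        = c * gaussDensity
            (vecM ((Xᵀ * X)⁻¹ * Xᵀ * Y * Ωm⁻¹ * Wᵀ * (W * Ωm⁻¹ * Wᵀ)⁻¹))
            ((σ2 • (W * Wᵀ)⁻¹ + τ2 • (1 : Matrix (Fin L) (Fin L) ℝ)) ⊗ₖ (Xᵀ * X)⁻¹)
            (vecM ξ) := by
  have hG : (W * Wᵀ).PosDef := posDef_mul_transpose_of_isUnit_det W hW
  have hXX : (Xᵀ * X).PosDef := by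
    simpa using posDef_mul_transpose_of_isUnit_det Xᵀ (by simpa using hX)
  have hWW : (Wᵀ * W).PosSemidef := by simpa using posSemidef_conjTranspose_mul_self W
  have hΩpos : Ωm.PosDef := by
    rw [hΩ]
    exact (PosDef.one.smul hσ).add_posSemidef (hWW.smul hτ.le)
  have hΩu : IsUnit Ωm.det := hΩpos.det_pos.ne'.isUnit
  have hV : (σ2 • (W * Wᵀ)⁻¹ + τ2 • (1 : Matrix (Fin L) (Fin L) ℝ)).PosDef :=
    (hG.inv.smul hσ).add (PosDef.one.smul hτ)
  have hVinv : (σ2 • (W * Wᵀ)⁻¹ + τ2 • (1 : Matrix (Fin L) (Fin L) ℝ))⁻¹ = W * Ωm⁻¹ * Wᵀ := by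
    subst hΩ
    exact inv_smul_inv_add_smul_one W hW σ2 τ2 hΩu
  have hS : (Ωm ⊗ₖ (1 : Matrix (Fin N) (Fin N) ℝ)).PosDef := hΩpos.kronecker PosDef.one
  have hT := hV.kronecker hXX.inv
  set M := (Xᵀ * X)⁻¹ * Xᵀ * Y * Ωm⁻¹ * Wᵀ * (W * Ωm⁻¹ * Wᵀ)⁻¹ with hM
  have hΩsymm : (Ωm⁻¹)ᵀ = Ωm⁻¹ := by simpa using hΩpos.inv.isHermitian.eq
  have hprec : IsUnit (W * Ωm⁻¹ * Wᵀ).det := by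
    rw [← hVinv]
    exact hV.inv.det_pos.ne'.isUnit
  have hmean (ξ : Matrix (Fin K) (Fin L) ℝ) : vecM (X * ξ * W) = (Wᵀ ⊗ₖ X) *ᵥ vecM ξ :=
    (kronecker_mulVec_vec X ξ Wᵀ).symm
  have hDP : (Wᵀ ⊗ₖ X)ᵀ * (Ωm ⊗ₖ (1 : Matrix (Fin N) (Fin N) ℝ))⁻¹ = (W * Ωm⁻¹) ⊗ₖ Xᵀ := by
    rw [inv_kronecker, inv_one, ← kroneckerMap_transpose, transpose_transpose, ← mul_kronecker_mul,
      Matrix.mul_one]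
  have hTinv : ((σ2 • (W * Wᵀ)⁻¹ + τ2 • (1 : Matrix (Fin L) (Fin L) ℝ)) ⊗ₖ (Xᵀ * X)⁻¹)⁻¹ =
      (W * Ωm⁻¹ * Wᵀ) ⊗ₖ (Xᵀ * X) := by
    rw [inv_kronecker, hVinv, nonsing_inv_nonsing_inv _ hX]
  have hnormal : ((W * Ωm⁻¹ * Wᵀ) ⊗ₖ (Xᵀ * X)) *ᵥ vecM M = ((W * Ωm⁻¹) ⊗ₖ Xᵀ) *ᵥ vecM Y := by
    refine (kronecker_mulVec_vec (Xᵀ * X) M (W * Ωm⁻¹ * Wᵀ)).trans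
      (Eq.trans (congrArg vec ?_) (kronecker_mulVec_vec Xᵀ Y (W * Ωm⁻¹)).symm)
    have ht : (W * Ωm⁻¹ * Wᵀ)ᵀ = W * Ωm⁻¹ * Wᵀ := by
      simp only [transpose_mul, transpose_transpose, hΩsymm, Matrix.mul_assoc]
    rw [ht, transpose_mul, hΩsymm, hM, Matrix.mul_assoc (Xᵀ * X),
      nonsing_inv_mul_cancel_right _ _ hprec]
    simp only [Matrix.mul_assoc]
    simp only [← Matrix.mul_assoc Xᵀ X]
    rw [mul_nonsing_inv_cancel_left _ _ hX]
  refine ⟨gaussDensity ((Wᵀ ⊗ₖ X) *ᵥ vecM M) (Ωm ⊗ₖ (1 : Matrix (Fin N) (Fin N) ℝ)) (vecM Y) /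
    gaussDensity (vecM M)
      ((σ2 • (W * Wᵀ)⁻¹ + τ2 • (1 : Matrix (Fin L) (Fin L) ℝ)) ⊗ₖ (Xᵀ * X)⁻¹) (vecM M),
    div_pos (gaussDensity_pos hS _ _) (gaussDensity_pos hT _ _), fun ξ => ?_⟩
  rw [hmean]
  refine gaussDensity_linear_eq hS hT _ _ _ ?_ ?_ _
  · rw [hTinv, hDP, ← mul_kronecker_mul]
  · rw [hTinv, hDP, hnormal]
end
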